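/- Let H be a topological space and (H_i)_{i∈ℕ} an increasing sequence of subsets of H with H = ⋃_i H_i (each H_i carrying the subspace topology) such that every compact subset of H is contained in some H_i. Fix m ∈ ℕ ∪ {∞} and suppose that for every i, the inclusion H_i ⊆ H_{i+1} has the following compression property for all n ≤ m (all n ∈ ℕ if m = ∞): every continuous map g : D^n → H_{i+1} from the closed n-disk with g(S^{n-1}) ⊆ H_i is homotopic rel S^{n-1} to a map whose image lies in H_i. Then the inclusion H_0 ⊆ H has the same compression property: for every n ≤ m, every continuous map g : D^n → H with g(S^{n-1}) ⊆ H_0 is homotopic rel S^{n-1} to a map whose image lies in H_0. -/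

import Mathlib

open unitInterval

/-- The compression property in dimension `n` for a pair of subsets `A ⊆ B` of a space `H`:
every continuous map `g : Dⁿ → H` with image in `B` and with `g(Sⁿ⁻¹) ⊆ A` is homotopic
rel `Sⁿ⁻¹`, through maps into `B`, to a map whose image lies in `A`.  Here `Dⁿ` is the
closed unit ball in `ℝⁿ` and `Sⁿ⁻¹` its boundary sphere. -/
def CompressionProperty {H : Type*} [TopologicalSpace H] (A B : Set H) (n : ℕ) : Prop :=
  ∀ g : (Metric.closedBall (0 : EuclideanSpace ℝ (Fin n)) 1) → H,
    Continuous g → (∀ x, g x ∈ B) →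
    (∀ x : (Metric.closedBall (0 : EuclideanSpace ℝ (Fin n)) 1),
        (x : EuclideanSpace ℝ (Fin n)) ∈ Metric.sphere (0 : EuclideanSpace ℝ (Fin n)) 1 →
        g x ∈ A) →
    ∃ F : unitInterval × (Metric.closedBall (0 : EuclideanSpace ℝ (Fin n)) 1) → H,
      Continuous F ∧ (∀ x, F (0, x) = g x) ∧ (∀ p, F p ∈ B) ∧
      (∀ (t : unitInterval) (x : (Metric.closedBall (0 : EuclideanSpace ℝ (Fin n)) 1)),
        (x : EuclideanSpace ℝ (Fin n)) ∈ Metric.sphere (0 : EuclideanSpace ℝ (Fin n)) 1 →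
        F (t, x) = g x) ∧
      (∀ x, F (1, x) ∈ A)

theorem CompressionProperty.trans_tower {H : Type*} [TopologicalSpace H] {A B C : Set H} {n : ℕ}
    (hAB : A ⊆ B) (hBC : B ⊆ C) (h1 : CompressionProperty A B n)
    (h2 : CompressionProperty B C n) : CompressionProperty A C n := by
  intro g hg hgC hgA
  obtain ⟨F, hF, hF0, hFC, hFs, hF1⟩ := h2 g hg hgC (fun x hx => hAB (hgA x hx))
  obtain ⟨G, hG, hG0, hGB, hGs, hG1⟩ := h1 (fun x => F (1, x)) (by fun_prop) hF1
    (fun x hx => by rw [hFs 1 x hx]; exact hgA x hx)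
  let P : C(Metric.closedBall (0 : EuclideanSpace ℝ (Fin n)) 1, H) → Prop := fun f =>
    (∀ x, f x ∈ C) ∧ ∀ x : (Metric.closedBall (0 : EuclideanSpace ℝ (Fin n)) 1),
      (x : EuclideanSpace ℝ (Fin n)) ∈ Metric.sphere (0 : EuclideanSpace ℝ (Fin n)) 1 → f x = g x
  let f0 : C(Metric.closedBall (0 : EuclideanSpace ℝ (Fin n)) 1, H) := ⟨g, hg⟩
  let f1 : C(Metric.closedBall (0 : EuclideanSpace ℝ (Fin n)) 1, H) :=
    ⟨fun x => F (1, x), by fun_prop⟩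
  let f2 : C(Metric.closedBall (0 : EuclideanSpace ℝ (Fin n)) 1, H) :=
    ⟨fun x => G (1, x), by fun_prop⟩
  let K1 : ContinuousMap.HomotopyWith f0 f1 P :=
    { toFun := F
      continuous_toFun := hF
      map_zero_left := hF0
      map_one_left := fun _ => rfl
      prop' := fun t => ⟨fun x => hFC (t, x), fun x hx => hFs t x hx⟩ }
  let K2 : ContinuousMap.HomotopyWith f1 f2 P :=
    { toFun := G
      continuous_toFun := hG
      map_zero_left := hG0
      map_one_left := fun _ => rfl
      prop' := fun t => ⟨fun x => hBC (hGB (t, x)),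
        fun x hx => (hGs t x hx).trans (hFs 1 x hx)⟩ }
  let K := K1.trans K2
  refine ⟨K, K.continuous, fun x => K.apply_zero x, fun p => (K.prop p.1).1 p.2,
    fun t x hx => (K.prop t).2 x hx, fun x => ?_⟩
  rw [K.apply_one x]
  exact hG1 x

theorem CompressionProperty.refl_tower {H : Type*} [TopologicalSpace H] (A : Set H) (n : ℕ) :
    CompressionProperty A A n := fun g hg hgA _ =>
  ⟨fun p => g p.2, by fun_prop, fun _ => rfl, fun p => hgA p.2, fun _ _ _ => rfl, hgA⟩

/-- If `H` is the union of an increasing sequence of subsets `H_ i` such that every compact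
subset of `H` lies in some `H_ i`, and for some `m ∈ ℕ ∪ {∞}` each inclusion
`H_ i ⊆ H_ (i+1)` has the compression property in all dimensions `n ≤ m`, then the
inclusion `H_ 0 ⊆ H` has the compression property in all dimensions `n ≤ m`. -/
theorem compression_of_tower
    {H : Type*} [TopologicalSpace H]
    (H_ : ℕ → Set H) (hmono : Monotone H_) (hunion : ∀ x : H, ∃ i, x ∈ H_ i)
    (hcpt : ∀ C : Set H, IsCompact C → ∃ i, C ⊆ H_ i)
    (m : ℕ∞)
    (hcompress : ∀ i : ℕ, ∀ n : ℕ, (n : ℕ∞) ≤ m →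
      CompressionProperty (H_ i) (H_ (i + 1)) n) :
    ∀ n : ℕ, (n : ℕ∞) ≤ m → CompressionProperty (H_ 0) (Set.univ : Set H) n := by
  intro n hn g hg _ hgA
  have key : ∀ i, CompressionProperty (H_ 0) (H_ i) n := by
    intro i
    induction i with
    | zero => exact CompressionProperty.refl_tower _ n
    | succ i ih =>
      exact CompressionProperty.trans_tower (hmono (Nat.zero_le i)) (hmono (Nat.le_succ i)) ih
        (hcompress i n hn)
  haveI : CompactSpace (Metric.closedBall (0 : EuclideanSpace ℝ (Fin n)) 1) :=
    isCompact_iff_compactSpace.mp (isCompact_closedBall _ _)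
  obtain ⟨i, hi⟩ := hcpt (Set.range g) (isCompact_range hg)
  obtain ⟨F, hF, hF0, _, hFs, hF1⟩ := key i g hg (fun x => hi ⟨x, rfl⟩) hgA
  exact ⟨F, hF, hF0, fun _ => Set.mem_univ _, hFs, hF1⟩
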